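/- arXiv:2411.19365 — 2 statements merged into one kernel-verified Lean document; each statement's English description precedes it below -/
import Mathlib

section
/- In every execution of the Figure 3 algorithm, whenever a Take operation performs a successful t&s() on TS[a], it holds at that step that Items[a] ≠ ⊥. -/
/-!
A formal model of the algorithm of Figure 3 (a wait-free, linearizable
1-bounded bag with one producer and `n` consumers).

Locations `1 .. n+1` are modelled as `Fin (n+1)` with index `0` playing the
role of location `1` (so `TS[1] = 1` initially becomes `ts 0 = true`).
Registers holding elements or `⊥` are modelled as `Option ℕ` (with `none` = ⊥),
test&set objects as `Bool` (`true` = 1).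

An execution is a list of actions (`Act`), each of which performs exactly one
shared-memory access (an invocation of an operation is merged with the first
shared access of that operation, and nondeterministic choices and results of
accesses are recorded in the action).  `step` is the (partial, deterministic)
transition function; a list `tr` is a (finite) execution iff
`run n tr (init n) = some C` for some configuration `C`.
-/

namespace Fig3

abbrev Loc (n : ℕ) := Fin (n + 1)

/-- Local state (program counter and local variables) of the single producer,
apart from the persistent local variables `used` and `m` that are kept in the
configuration. -/
inductive PSt (n : ℕ) where
  | idle : PSt n
  | clear (x : ℕ) : PSt n
  | collect (x : ℕ) (i : ℕ) (hz : Finset (Loc n)) : PSt n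
  | allocSt (x : ℕ) (hz : Finset (Loc n)) : PSt n
  | resets (x : ℕ) (hz : Finset (Loc n)) (todo : Finset (Loc n)) : PSt n
  deriving DecidableEq

/-- Local state of a consumer. -/
inductive CSt (n : ℕ) where
  | idle : CSt n
  | haz (a : Loc n) : CSt n
  | read (a : Loc n) : CSt n
  | tas (a : Loc n) (x : ℕ) : CSt n
  | clear (res : Option ℕ) : CSt n
  deriving DecidableEq

structure Cfg (n : ℕ) where
  items : Loc n → Option ℕ
  ts : Loc n → Bool
  alloc : Loc n
  haz : Fin n → Option (Loc n)
  pst : PSt n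
  used : Finset (Loc n)
  m : Loc n
  cst : Fin n → CSt n

inductive Act (n : ℕ) where
  /-- the producer begins `Insert(x)` by reading `TS[m]`, obtaining `v`;
      if `v = false` (i.e. 0) the operation immediately returns FULL -/
  | insCheck (x : ℕ) (v : Bool) : Act n
  /-- the producer writes ⊥ to `Items[m]` and adds `m` to `used` -/
  | insClear : Act n
  /-- the producer reads the next entry of `Hazards` -/
  | insCollect : Act n
  /-- the producer chooses a fresh non-hazardous location `m'`
      and writes it to `Allocated` -/
  | insAlloc (m' : Loc n) : Act n
  /-- the producer resets `TS[k]` -/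
  | insReset (k : Loc n) : Act n
  /-- the producer writes its element to `Items[m]` and returns OK -/
  | insWrite : Act n
  /-- consumer `i` begins `Take()` by reading `Allocated`, obtaining `a` -/
  | takeBegin (i : Fin n) (a : Loc n) : Act n
  /-- consumer `i` writes its announced location to `Hazards[i]` -/
  | takeHaz (i : Fin n) : Act n
  /-- consumer `i` reads `Items[a]`, obtaining `x` -/
  | takeRead (i : Fin n) (x : Option ℕ) : Act n
  /-- consumer `i` performs `t&s()` on `TS[a]`; `won = true` iff it was successful -/
  | takeTas (i : Fin n) (won : Bool) : Act n
  /-- consumer `i` writes ⊥ to `Hazards[i]` and returns `res`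
      (`none` meaning EMPTY) -/
  | takeEnd (i : Fin n) (res : Option ℕ) : Act n
  deriving DecidableEq

/-- One step of the algorithm: `step n C e = some C'` iff action `e` is enabled
in configuration `C` (including that all recorded read/`t&s` results match the
shared state) and leads to configuration `C'`. -/
def step (n : ℕ) (C : Cfg n) : Act n → Option (Cfg n)
  | .insCheck x v =>
      match C.pst with
      | .idle =>
          if v = C.ts C.m then
            some (if v then { C with pst := .clear x } else C)
          else none
      | _ => none
  | .insClear =>
      match C.pst with
      | .clear x =>
          some { C with
                   items := Function.update C.items C.m none
                   used := insert C.m C.used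
                   pst := if n = 0 then .allocSt x ∅ else .collect x 0 ∅ }
      | _ => none
  | .insCollect =>
      match C.pst with
      | .collect x i hz =>
          if h : i < n then
            let hz' := match C.haz ⟨i, h⟩ with
                       | some a => insert a hz
                       | none => hz
            some { C with pst := if i + 1 = n then .allocSt x hz' else .collect x (i + 1) hz' }
          else none
      | _ => none
  | .insAlloc m' =>
      match C.pst with
      | .allocSt x hz =>
          if m' ∈ hz then none
          else some { C with
                        alloc := m'
                        m := m'
                        pst := .resets x hz (C.used \ hz) }
      | _ => none
  | .insReset k =>
      match C.pst with
      | .resets x hz todo =>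
          if k ∈ todo then
            some { C with
                     ts := Function.update C.ts k false
                     pst := .resets x hz (todo.erase k) }
          else none
      | _ => none
  | .insWrite =>
      match C.pst with
      | .resets x hz todo =>
          if todo = ∅ then
            some { C with
                     items := Function.update C.items C.m (some x)
                     used := C.used ∩ hz
                     pst := .idle }
          else none
      | _ => none
  | .takeBegin i a =>
      match C.cst i with
      | .idle =>
          if a = C.alloc then some { C with cst := Function.update C.cst i (.haz a) }
          else none
      | _ => none
  | .takeHaz i =>
      match C.cst i with
      | .haz a =>
          some { C with
                   haz := Function.update C.haz i (some a)
                   cst := Function.update C.cst i (.read a) }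
      | _ => none
  | .takeRead i xo =>
      match C.cst i with
      | .read a =>
          if xo = C.items a then
            some { C with
                     cst := Function.update C.cst i
                       (match xo with
                        | some v => .tas a v
                        | none => .clear none) }
          else none
      | _ => none
  | .takeTas i won =>
      match C.cst i with
      | .tas a x =>
          if won = !(C.ts a) then
            some { C with
                     ts := Function.update C.ts a true
                     cst := Function.update C.cst i (.clear (if won then some x else none)) }
          else none
      | _ => none
  | .takeEnd i res =>
      match C.cst i with
      | .clear r =>
          if res = r then
            some { C with
                     haz := Function.update C.haz i none
                     cst := Function.update C.cst i .idle }
          else none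
      | _ => none

/-- The initial configuration: all items ⊥, `TS[1] = 1` and all other test&set
objects 0, `Allocated = m = 1`, `used = ∅`, everyone idle. -/
def init (n : ℕ) : Cfg n where
  items := fun _ => none
  ts := fun k => decide (k = 0)
  alloc := 0
  haz := fun _ => none
  pst := .idle
  used := ∅
  m := 0
  cst := fun _ => .idle

/-- Run a list of actions from a configuration. -/
def run (n : ℕ) : List (Act n) → Cfg n → Option (Cfg n)
  | [], C => some C
  | e :: tr, C => (step n C e).bind (run n tr)

/-- The configuration reached after the first `t` actions of `tr`. -/
def cfgAt (n : ℕ) (tr : List (Act n)) (t : ℕ) : Option (Cfg n) :=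
  run n (tr.take t) (init n)

end Fig3

namespace Fig3

/-- What the producer knows about a location `a` announced as hazardous by consumer `i`. -/
def Prot (n : ℕ) (C : Cfg n) (i : Fin n) (a : Loc n) : Prop :=
  match C.pst with
  | .idle => True
  | .clear _ => True
  | .collect _ j hz => i.val < j → a ∈ hz
  | .allocSt _ hz => a ∈ hz
  | .resets _ hz todo => a ∈ hz ∧ a ∉ todo

/-- The inductive invariant. -/
structure Inv (n : ℕ) (C : Cfg n) : Prop where
  hread : ∀ i a, C.cst i = .read a → C.haz i = some a
  htas : ∀ i a x, C.cst i = .tas a x → C.haz i = some a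
  hclear : ∀ x, C.pst = .clear x → C.ts C.m = true
  hmain : ∀ i a x, C.cst i = .tas a x → C.items a = none → C.ts a = true ∧ Prot n C i a

theorem inv_init (n : ℕ) : Inv n (init n) := by
  constructor <;> simp [init]

theorem inv_step (n : ℕ) (C C' : Cfg n) (e : Act n) (h : Inv n C)
    (hs : step n C e = some C') : Inv n C' := by
  obtain ⟨h1, h2, h3, h4⟩ := h
  unfold Prot at h4
  cases e <;> simp only [step] at hs
  case insCollect =>
    split at hs <;> try contradiction
    rename_i x j hz hp
    split at hs <;> try contradiction
    rename_i hj
    simp only [Option.some.injEq] at hs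
    subst hs
    refine ⟨h1, h2, ?_, ?_⟩
    · intro y hy
      simp only at hy
      split at hy <;> contradiction
    · intro i a y hi ha
      have hh := h2 i a y hi
      obtain ⟨g1, g2⟩ := h4 i a y hi ha
      refine ⟨g1, ?_⟩
      rw [hp] at g2
      simp only at g2
      have key : i.val < j + 1 → a ∈ (match C.haz ⟨j, hj⟩ with
                       | some a => insert a hz
                       | none => hz) := by
        intro hlt
        by_cases hij : i.val = j
        · have : (⟨j, hj⟩ : Fin n) = i := by ext; simp [hij]
          rw [this, hh]
          simp
        · have := g2 (by omega)
          split
          · exact Finset.mem_insert_of_mem this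
          · exact this
      unfold Prot
      simp only
      by_cases hn : j + 1 = n
      · simp only [hn, if_true]
        exact key (by omega)
      · simp only [hn, if_false]
        exact key
  case insClear =>
    split at hs <;> try contradiction
    rename_i x hp
    simp only [Option.some.injEq] at hs
    subst hs
    refine ⟨h1, h2, ?_, ?_⟩
    · intro y hy
      simp only at hy
      split at hy <;> contradiction
    · intro i a y hi ha
      have hn : n ≠ 0 := by have := i.isLt; omega
      have := h3 x hp
      refine ⟨?_, by simp [Prot, hn]⟩
      by_cases ham : a = C.m
      · rw [ham]; exact this
      · simp only [Function.update_of_ne ham] at ha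
        exact (h4 i a y hi ha).1
  case insCheck x v =>
    split at hs <;> try contradiction
    split at hs <;> try contradiction
    cases v <;> simp at hs <;> subst hs
    · exact ⟨h1, h2, h3, h4⟩
    · constructor <;> (try simp only [Prot]) <;> grind
  all_goals
    split at hs <;> try contradiction
  all_goals
    (try split at hs) <;> try contradiction
  all_goals
    simp only [Option.some.injEq] at hs
    subst hs
    constructor <;> (try simp only [Prot]) <;> grind [Function.update_apply]

theorem inv_run (n : ℕ) (tr : List (Act n)) : ∀ (C C' : Cfg n), Inv n C →
    run n tr C = some C' → Inv n C' := by
  induction tr with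
  | nil =>
    intro C C' h hr
    simp only [run, Option.some.injEq] at hr
    exact hr ▸ h
  | cons e tr ih =>
    intro C C' h hr
    simp only [run, Option.bind_eq_some_iff] at hr
    obtain ⟨D, hD, hr⟩ := hr
    exact ih D C' (inv_step n C D e h hD) hr

end Fig3

/--
In every execution of the Figure 3 algorithm, whenever a
`Take` operation performs a successful `t&s()` on `TS[a]`, it holds at that
step that `Items[a] ≠ ⊥`.

Here consumer `i` is poised to perform `t&s()` on `TS[a]` exactly when its
local state is `CSt.tas a x`, and the successful `t&s` is the enabled action
`Act.takeTas i true`.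
-/
theorem fig3_successful_tas_implies_item_present (n : ℕ) (tr : List (Fig3.Act n))
    (C C' : Fig3.Cfg n) (i : Fin n) (a : Fig3.Loc n) (x : ℕ)
    (hrun : Fig3.run n tr (Fig3.init n) = some C)
    (hst : C.cst i = Fig3.CSt.tas a x)
    (hstep : Fig3.step n C (Fig3.Act.takeTas i true) = some C') :
    C.items a ≠ none := by
  intro ha
  have h := Fig3.inv_run n tr _ _ (Fig3.inv_init n) hrun
  have := (h.hmain i a x hst ha).1
  simp [Fig3.step, hst, this] at hstep
end

section
/- In every configuration of every execution of the Figure 5 algorithm: for every index a, if Items[a] ≠ ⊥ then a belongs to the producer's local set alloc; moreover, the producer's local set alloc always satisfies |alloc| ≤ b. -/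
/-!
A formal model of the algorithm of Figure 5 (a lock-free,
strongly-linearizable `b`-bounded bag with one producer and `n` consumers).

Locations `1 .. n+b` are modelled as `Fin (n+b)`.  Registers holding elements
or ⊥ are modelled as `Option ℕ` (`none` = ⊥) and test&set objects as `Bool`
(`true` = 1).  The ABA-detecting registers `InsertDone` and `TakeDone` are
modelled by write counters (`icount`, `tcount`) together with the counter
value recorded at the last `dRead()` of each reader (`ilast i` for consumer
`i` reading `InsertDone`; `tlast` for the producer reading `TakeDone`); a
`dRead()` returns `true` iff the reader has read before and the counter has
increased since.

An execution is a list of actions (`Act`), each performing (at most) one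
shared-memory access; results of accesses and nondeterministic choices are
recorded in the action.  `step` is the (partial) transition function.  The
purely local control transitions at the end of the producer's scan of `alloc`
(`insScanDone`) are modelled as separate actions.
-/

namespace Fig5

/-- Local state of the producer, besides the persistent local variables
`used` and `alloc` kept in the configuration. -/
inductive PSt (n b : ℕ) where
  | idle : PSt n b
  /-- scanning the locations of `alloc` that are still `pending` -/
  | scan (x : ℕ) (pending : Finset (Fin (n + b))) : PSt n b
  /-- collecting `Hazards`; `i` is the next index to read -/
  | collect (x : ℕ) (i : ℕ) (hz : Finset (Fin (n + b))) : PSt n b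
  /-- about to choose a fresh location and write `Allocated` -/
  | allocSt (x : ℕ) (hz : Finset (Fin (n + b))) : PSt n b
  /-- chose location `m`; resetting the test&set objects in `todo` -/
  | resets (x : ℕ) (hz : Finset (Fin (n + b))) (m : Fin (n + b))
      (todo : Finset (Fin (n + b))) : PSt n b
  /-- wrote the element, about to perform `InsertDone.dWrite()` -/
  | dw : PSt n b
  /-- `|alloc| = b`; about to re-read `TakeDone` -/
  | recheck (x : ℕ) : PSt n b
  deriving DecidableEq

/-- Local state of a consumer. -/
inductive CSt (n b : ℕ) where
  | idle : CSt n b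
  /-- about to read `Allocated` -/
  | loopStart : CSt n b
  /-- iterating over the locations read from `Allocated` that are still
      `pending` -/
  | scan (pending : Finset (Fin (n + b))) : CSt n b
  /-- about to write `a` to `Hazards[i]` -/
  | haz (pending : Finset (Fin (n + b))) (a : Fin (n + b)) : CSt n b
  /-- about to read `Items[a]` -/
  | read (pending : Finset (Fin (n + b))) (a : Fin (n + b)) : CSt n b
  /-- read `x ≠ ⊥` from `Items[a]`, about to perform `t&s()` on `TS[a]` -/
  | tas (pending : Finset (Fin (n + b))) (a : Fin (n + b)) (x : ℕ) : CSt n b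
  /-- successful `t&s`; about to write ⊥ to `Hazards[i]` -/
  | retClear (x : ℕ) : CSt n b
  /-- about to perform `TakeDone.dWrite()` and return `x` -/
  | retDone (x : ℕ) : CSt n b
  /-- about to re-read `InsertDone` -/
  | recheck : CSt n b
  /-- about to perform `TakeDone.dWrite()` and return EMPTY -/
  | emptyDone : CSt n b
  deriving DecidableEq

structure Cfg (n b : ℕ) where
  items : Fin (n + b) → Option ℕ
  ts : Fin (n + b) → Bool
  /-- the shared register `Allocated` -/
  allocated : Finset (Fin (n + b))
  haz : Fin n → Option (Fin (n + b))
  /-- number of `dWrite()`s to `InsertDone` -/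
  icount : ℕ
  /-- value of `icount` at consumer `i`'s last `dRead()` of `InsertDone` -/
  ilast : Fin n → Option ℕ
  /-- number of `dWrite()`s to `TakeDone` -/
  tcount : ℕ
  /-- value of `tcount` at the producer's last `dRead()` of `TakeDone` -/
  tlast : Option ℕ
  pst : PSt n b
  /-- the producer's persistent local variable `used` -/
  used : Finset (Fin (n + b))
  /-- the producer's persistent local variable `alloc` -/
  palloc : Finset (Fin (n + b))
  cst : Fin n → CSt n b

inductive Act (n b : ℕ) where
  /-- the producer begins `Insert(x)` by performing `TakeDone.dRead()` -/
  | insBegin (x : ℕ) : Act n b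
  /-- the producer reads `TS[m]` for the pending location `m` of its scan,
      obtaining `v`; if `v = true` it also writes ⊥ to `Items[m]`, removes `m`
      from `alloc` and adds it to `used` -/
  | insScan (m : Fin (n + b)) (v : Bool) : Act n b
  /-- local step: the scan is finished; proceed according to `|alloc| < b` -/
  | insScanDone : Act n b
  /-- the producer reads the next entry of `Hazards` -/
  | insCollect : Act n b
  /-- the producer chooses a fresh location `m'` (not in `alloc` and not
      hazardous), adds it to `alloc` and writes `alloc` to `Allocated` -/
  | insAlloc (m' : Fin (n + b)) : Act n b
  /-- the producer resets `TS[k]` -/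
  | insReset (k : Fin (n + b)) : Act n b
  /-- the producer writes its element to `Items[m]` -/
  | insWrite : Act n b
  /-- the producer performs `InsertDone.dWrite()` and returns OK -/
  | insDone : Act n b
  /-- the producer re-reads `TakeDone`, obtaining `v`; if `v = false` the
      `Insert` completes returning FULL -/
  | insRecheck (v : Bool) : Act n b
  /-- consumer `i` begins `Take()` by performing `InsertDone.dRead()` -/
  | takeBegin (i : Fin n) : Act n b
  /-- consumer `i` reads `Allocated` -/
  | takeAlloc (i : Fin n) : Act n b
  /-- consumer `i` picks the pending location `a` and writes it to
      `Hazards[i]` -/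
  | takeHaz (i : Fin n) (a : Fin (n + b)) : Act n b
  /-- consumer `i` reads `Items[a]`, obtaining `xo` -/
  | takeRead (i : Fin n) (xo : Option ℕ) : Act n b
  /-- consumer `i` performs `t&s()` on `TS[a]`; `won = true` iff successful -/
  | takeTas (i : Fin n) (won : Bool) : Act n b
  /-- consumer `i` finished its scan; it writes ⊥ to `Hazards[i]` -/
  | takeScanEnd (i : Fin n) : Act n b
  /-- consumer `i` writes ⊥ to `Hazards[i]` after a successful `t&s` -/
  | takeRetClear (i : Fin n) : Act n b
  /-- consumer `i` performs `TakeDone.dWrite()` and returns `x` -/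
  | takeRetDone (i : Fin n) (x : ℕ) : Act n b
  /-- consumer `i` re-reads `InsertDone`, obtaining `v` -/
  | takeRecheck (i : Fin n) (v : Bool) : Act n b
  /-- consumer `i` performs `TakeDone.dWrite()` and returns EMPTY -/
  | takeEmptyDone (i : Fin n) : Act n b
  deriving DecidableEq

/-- Result of an `InsertDone.dRead()` by consumer `i`. -/
def ireadVal {n b : ℕ} (C : Cfg n b) (i : Fin n) : Bool :=
  match C.ilast i with
  | none => false
  | some c => decide (c < C.icount)

/-- Result of a `TakeDone.dRead()` by the producer. -/
def treadVal {n b : ℕ} (C : Cfg n b) : Bool :=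
  match C.tlast with
  | none => false
  | some c => decide (c < C.tcount)

def step (n b : ℕ) (C : Cfg n b) : Act n b → Option (Cfg n b)
  | .insBegin x =>
      match C.pst with
      | .idle =>
          some { C with
                   tlast := some C.tcount
                   pst := .scan x C.palloc }
      | _ => none
  | .insScan m v =>
      match C.pst with
      | .scan x pending =>
          if m ∈ pending ∧ v = C.ts m then
            if v then
              some { C with
                       items := Function.update C.items m none
                       palloc := C.palloc.erase m
                       used := insert m C.used
                       pst := .scan x (pending.erase m) }
            else
              some { C with pst := .scan x (pending.erase m) }
          else none
      | _ => none
  | .insScanDone =>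
      match C.pst with
      | .scan x pending =>
          if pending = ∅ then
            if C.palloc.card < b then
              some { C with pst := if n = 0 then .allocSt x ∅ else .collect x 0 ∅ }
            else
              some { C with pst := .recheck x }
          else none
      | _ => none
  | .insCollect =>
      match C.pst with
      | .collect x i hz =>
          if h : i < n then
            let hz' := match C.haz ⟨i, h⟩ with
                       | some a => insert a hz
                       | none => hz
            some { C with pst := if i + 1 = n then .allocSt x hz' else .collect x (i + 1) hz' }
          else none
      | _ => none
  | .insAlloc m' =>
      match C.pst with
      | .allocSt x hz =>
          if m' ∈ C.palloc ∨ m' ∈ hz then none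
          else
            some { C with
                     palloc := insert m' C.palloc
                     allocated := insert m' C.palloc
                     pst := .resets x hz m' (C.used \ hz) }
      | _ => none
  | .insReset k =>
      match C.pst with
      | .resets x hz m todo =>
          if k ∈ todo then
            some { C with
                     ts := Function.update C.ts k false
                     pst := .resets x hz m (todo.erase k) }
          else none
      | _ => none
  | .insWrite =>
      match C.pst with
      | .resets x hz m todo =>
          if todo = ∅ then
            some { C with
                     items := Function.update C.items m (some x)
                     used := C.used ∩ hz
                     pst := .dw }
          else none
      | _ => none
  | .insDone =>
      match C.pst with
      | .dw => some { C with icount := C.icount + 1, pst := .idle }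
      | _ => none
  | .insRecheck v =>
      match C.pst with
      | .recheck x =>
          if v = treadVal C then
            some { C with
                     tlast := some C.tcount
                     pst := if v then .scan x C.palloc else .idle }
          else none
      | _ => none
  | .takeBegin i =>
      match C.cst i with
      | .idle =>
          some { C with
                   ilast := Function.update C.ilast i (some C.icount)
                   cst := Function.update C.cst i .loopStart }
      | _ => none
  | .takeAlloc i =>
      match C.cst i with
      | .loopStart =>
          some { C with cst := Function.update C.cst i (.scan C.allocated) }
      | _ => none
  | .takeHaz i a =>
      match C.cst i with
      | .scan pending =>
          if a ∈ pending then
            some { C with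
                     haz := Function.update C.haz i (some a)
                     cst := Function.update C.cst i (.read (pending.erase a) a) }
          else none
      | _ => none
  | .takeRead i xo =>
      match C.cst i with
      | .read pending a =>
          if xo = C.items a then
            some { C with
                     cst := Function.update C.cst i
                       (match xo with
                        | some v => .tas pending a v
                        | none => .scan pending) }
          else none
      | _ => none
  | .takeTas i won =>
      match C.cst i with
      | .tas pending a x =>
          if won = !(C.ts a) then
            some { C with
                     ts := Function.update C.ts a true
                     cst := Function.update C.cst i
                       (if won then .retClear x else .scan pending) }
          else none
      | _ => none
  | .takeScanEnd i =>
      match C.cst i with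
      | .scan pending =>
          if pending = ∅ then
            some { C with
                     haz := Function.update C.haz i none
                     cst := Function.update C.cst i .recheck }
          else none
      | _ => none
  | .takeRetClear i =>
      match C.cst i with
      | .retClear x =>
          some { C with
                   haz := Function.update C.haz i none
                   cst := Function.update C.cst i (.retDone x) }
      | _ => none
  | .takeRetDone i x =>
      match C.cst i with
      | .retDone x' =>
          if x = x' then
            some { C with
                     tcount := C.tcount + 1
                     cst := Function.update C.cst i .idle }
          else none
      | _ => none
  | .takeRecheck i v =>
      match C.cst i with
      | .recheck =>
          if v = ireadVal C i then
            some { C with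
                     ilast := Function.update C.ilast i (some C.icount)
                     cst := Function.update C.cst i (if v then .loopStart else .emptyDone) }
          else none
      | _ => none
  | .takeEmptyDone i =>
      match C.cst i with
      | .emptyDone =>
          some { C with
                   tcount := C.tcount + 1
                   cst := Function.update C.cst i .idle }
      | _ => none

def init (n b : ℕ) : Cfg n b where
  items := fun _ => none
  ts := fun _ => false
  allocated := ∅
  haz := fun _ => none
  icount := 0
  ilast := fun _ => none
  tcount := 0
  tlast := none
  pst := .idle
  used := ∅
  palloc := ∅
  cst := fun _ => .idle

def run (n b : ℕ) : List (Act n b) → Cfg n b → Option (Cfg n b)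
  | [], C => some C
  | e :: tr, C => (step n b C e).bind (run n b tr)

/-- The configuration reached after the first `t` actions of `tr`. -/
def cfgAt (n b : ℕ) (tr : List (Act n b)) (t : ℕ) : Option (Cfg n b) :=
  run n b (tr.take t) (init n b)

end Fig5

namespace Fig5

/-- Control-state part of the invariant. -/
def PInv {n b : ℕ} (palloc : Finset (Fin (n + b))) : PSt n b → Prop
  | .collect _ _ _ => palloc.card < b
  | .allocSt _ _ => palloc.card < b
  | .resets _ _ m _ => m ∈ palloc
  | _ => True

/-- The inductive invariant. -/
def Inv {n b : ℕ} (C : Cfg n b) : Prop :=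
  (∀ a, C.items a ≠ none → a ∈ C.palloc) ∧ C.palloc.card ≤ b ∧ PInv C.palloc C.pst

theorem inv_step {n b : ℕ} (C C' : Cfg n b) (e : Act n b) (h : Inv C)
    (hs : step n b C e = some C') : Inv C' := by
  obtain ⟨h1, h2, h3⟩ := h
  cases e with
  | insScan m v =>
    simp only [step] at hs
    split at hs <;> try contradiction
    split_ifs at hs
    · cases hs
      refine ⟨fun a ha => ?_, (Finset.card_erase_le).trans h2, trivial⟩
      by_cases ham : a = m
      · subst ham
        simp at ha
      · simp only [Function.update_of_ne ham] at ha
        exact Finset.mem_erase.2 ⟨ham, h1 a ha⟩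
    · cases hs
      exact ⟨h1, h2, trivial⟩
  | insAlloc m =>
    simp only [step] at hs
    split at hs <;> try contradiction
    rename_i x hz hp
    rw [hp] at h3
    split_ifs at hs
    cases hs
    refine ⟨fun a ha => Finset.mem_insert_of_mem (h1 a ha), ?_, Finset.mem_insert_self _ _⟩
    exact (Finset.card_insert_le _ _).trans h3
  | insWrite =>
    simp only [step] at hs
    split at hs <;> try contradiction
    rename_i x hz m todo hp
    rw [hp] at h3
    split_ifs at hs
    cases hs
    refine ⟨fun a ha => ?_, h2, trivial⟩
    by_cases ham : a = m
    · subst ham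
      exact h3
    · simp only [Function.update_of_ne ham] at ha
      exact h1 a ha
  | insScanDone =>
    simp only [step] at hs
    split at hs <;> try contradiction
    split_ifs at hs <;> cases hs <;> refine ⟨h1, h2, ?_⟩ <;> simp_all [PInv]
  | insCollect =>
    simp only [step] at hs
    split at hs <;> try contradiction
    rename_i hp
    rw [hp] at h3
    split_ifs at hs <;> cases hs <;> refine ⟨h1, h2, ?_⟩ <;> exact h3
  | insReset k =>
    simp only [step] at hs
    split at hs <;> try contradiction
    rename_i hp
    rw [hp] at h3
    split_ifs at hs
    cases hs
    exact ⟨h1, h2, h3⟩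
  | insRecheck v =>
    simp only [step] at hs
    split at hs <;> try contradiction
    split_ifs at hs <;> cases hs <;> exact ⟨h1, h2, trivial⟩
  | insBegin | insDone =>
    simp only [step] at hs
    split at hs <;> try contradiction
    cases hs
    exact ⟨h1, h2, trivial⟩
  | _ =>
    simp only [step] at hs
    split at hs <;> try contradiction
    try split_ifs at hs
    all_goals
      cases hs
      exact ⟨h1, h2, h3⟩

theorem inv_run {n b : ℕ} (tr : List (Act n b)) (C C' : Cfg n b) (h : Inv C)
    (hr : run n b tr C = some C') : Inv C' := by
  induction tr generalizing C with
  | nil =>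
    simp only [run, Option.some.injEq] at hr
    exact hr ▸ h
  | cons e tr ih =>
    simp only [run, Option.bind_eq_some_iff] at hr
    obtain ⟨D, hD, hr⟩ := hr
    exact ih D (inv_step C D e h hD) hr

theorem inv_init (n b : ℕ) : Inv (init n b) := by
  simp [Inv, init, PInv]

end Fig5

/--
In every configuration of every execution of the Figure 5
algorithm: for every index `a`, if `Items[a] ≠ ⊥` then `a` belongs to the
producer's local set `alloc`; moreover, the producer's local set `alloc`
always satisfies `|alloc| ≤ b`.
-/
theorem fig5_items_alloc_invariant (n b : ℕ) (tr : List (Fig5.Act n b)) (C : Fig5.Cfg n b)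
    (hrun : Fig5.run n b tr (Fig5.init n b) = some C) :
    (∀ a, C.items a ≠ none → a ∈ C.palloc) ∧ C.palloc.card ≤ b := by
  have h := Fig5.inv_run tr _ C (Fig5.inv_init n b) hrun
  exact ⟨h.1, h.2.1⟩
end
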